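/- arXiv:0902.4508 — 2 statements merged into one kernel-verified Lean document; each statement's English description precedes it below -/
import Mathlib

section
/- Suppose d' = d. Then the number of pairs (α,β) ∈ F_{p^m} × F_q with (α,β) ≠ (0,0) for which the map φ_{α,β}(x) = α x^{p^m} + β x^{p^k} + β^{p^{n−k}} x^{p^{n−k}} has exactly p^d zeros in F_q (equivalently, the associated quadratic form has rank s−1) is p^{m−d}(p^n − 1). -/
open scoped BigOperators Classical

noncomputable section

/-- The map `φ_{α,β}(x) = α x^{p^m} + β x^{p^k} + β^{p^{n-k}} x^{p^{n-k}}`. -/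
def phiMap (p m n k : ℕ) {F : Type} [Field F] (α β x : F) : F :=
  α * x ^ p ^ m + β * x ^ p ^ k + β ^ p ^ (n - k) * x ^ p ^ (n - k)

/-- The trace-type sum `x ↦ ∑_{i<r} x^{p^{t i}}`; for `x` in the subfield of size
`p^{t·r}` this is the relative trace down to the subfield of size `p^t`. -/
def trSum (p t r : ℕ) {F : Type} [Field F] (x : F) : F :=
  ∑ i ∈ Finset.range r, x ^ p ^ (t * i)

/-- `ζ_p^c = exp(2πi·c̃/p)` for a lift `c̃` of `c : F_p`. -/
noncomputable def expChar (p : ℕ) (c : ZMod p) : ℂ :=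
  Complex.exp (2 * Real.pi * Complex.I * (c.val : ℂ) / (p : ℂ))

/-- Identify an element of the prime field of `F` with an element of `ZMod p`
(the partial inverse of the algebra map). -/
noncomputable def fToZMod (p : ℕ) {F : Type} [Field F] [Algebra (ZMod p) F] (x : F) : ZMod p :=
  letI : Nonempty (ZMod p) := ⟨0⟩
  Function.invFun (algebraMap (ZMod p) F) x

/-- `T(α,β) = ∑_{x ∈ F_q} ζ_p^{Tr^m_1(α x^{p^m+1}) + Tr^n_1(β x^{p^k+1})}`. -/
noncomputable def Tsum (p m n k : ℕ) (F : Type) [Field F] [Fintype F] [Algebra (ZMod p) F]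
    (α β : F) : ℂ :=
  ∑ x : F, expChar p (fToZMod p (trSum p 1 m (α * x ^ (p ^ m + 1))) +
      fToZMod p (trSum p 1 n (β * x ^ (p ^ k + 1))))

/-- `S(α,β,γ) = ∑_{x ∈ F_q} ζ_p^{Tr^m_1(α x^{p^m+1}) + Tr^n_1(β x^{p^k+1} + γ x)}`. -/
noncomputable def Ssum (p m n k : ℕ) (F : Type) [Field F] [Fintype F] [Algebra (ZMod p) F]
    (α β γ : F) : ℂ :=
  ∑ x : F, expChar p (fToZMod p (trSum p 1 m (α * x ^ (p ^ m + 1))) +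
      fToZMod p (trSum p 1 n (β * x ^ (p ^ k + 1) + γ * x)))

/-- `√(q₀*)` where `q₀* = (−1)^{(q₀−1)/2} q₀`. -/
noncomputable def sqrtStar (q0 : ℕ) : ℂ :=
  if q0 % 4 = 1 then (Real.sqrt q0 : ℂ) else Complex.I * (Real.sqrt q0 : ℂ)

/-- `ζ_p = exp(2πi/p)`. -/
noncomputable def zetaC (p : ℕ) : ℂ := Complex.exp (2 * Real.pi * Complex.I / (p : ℂ))

/-- Number of pairs `(α,β) ∈ F_{p^m} × F_q` with `T(α,β) = v`. -/
noncomputable def Tcount (p m n k : ℕ) (F : Type) [Field F] [Fintype F] [Algebra (ZMod p) F]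
    (v : ℂ) : ℕ :=
  Nat.card {ab : F × F // ab.1 ^ p ^ m = ab.1 ∧ Tsum p m n k F ab.1 ab.2 = v}

/-- Number of triples `(α,β,γ) ∈ F_{p^m} × F_q × F_q` with `S(α,β,γ) = v`. -/
noncomputable def Scount (p m n k : ℕ) (F : Type) [Field F] [Fintype F] [Algebra (ZMod p) F]
    (v : ℂ) : ℕ :=
  Nat.card {abc : F × F × F // abc.1 ^ p ^ m = abc.1 ∧ Ssum p m n k F abc.1 abc.2.1 abc.2.2 = v}

/-- Hamming weight of the codeword of `C₁` attached to `(α,β)`: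
the number of `0 ≤ i ≤ q-2` with `Tr^m_t(α π^{i(p^m+1)}) + Tr^n_t(β π^{i(p^k+1)}) ≠ 0`. -/
noncomputable def wt1 (p m n k t : ℕ) {F : Type} [Field F] (π α β : F) : ℕ :=
  Nat.card {i : ℕ // i ≤ p ^ n - 2 ∧
    trSum p t (m / t) (α * π ^ (i * (p ^ m + 1))) +
    trSum p t (n / t) (β * π ^ (i * (p ^ k + 1))) ≠ 0}

/-- Number of pairs `(α,β) ∈ F_{p^m} × F_q` whose `C₁`-codeword has weight `v`. -/
noncomputable def wt1count (p m n k t : ℕ) (F : Type) [Field F] [Fintype F] (π : F) (v : ℕ) : ℕ :=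
  Nat.card {ab : F × F // ab.1 ^ p ^ m = ab.1 ∧ wt1 p m n k t π ab.1 ab.2 = v}

/-- Hamming weight of the codeword of `C₂` attached to `(α,β,γ)`. -/
noncomputable def wt2 (p m n k t : ℕ) {F : Type} [Field F] (π α β γ : F) : ℕ :=
  Nat.card {i : ℕ // i ≤ p ^ n - 2 ∧
    trSum p t (m / t) (α * π ^ (i * (p ^ m + 1))) +
    trSum p t (n / t) (β * π ^ (i * (p ^ k + 1)) + γ * π ^ i) ≠ 0}

/-- Number of triples `(α,β,γ)` whose `C₂`-codeword has weight `v`. -/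
noncomputable def wt2count (p m n k t : ℕ) (F : Type) [Field F] [Fintype F] (π : F) (v : ℕ) : ℕ :=
  Nat.card {abc : F × F × F // abc.1 ^ p ^ m = abc.1 ∧ wt2 p m n k t π abc.1 abc.2.1 abc.2.2 = v}

section TwistedTrinomial

variable {F : Type*} [Field F] {σ τ : F ≃+* F}

lemma fixed_of_twisted_zero (hττ : ∀ x, τ (τ x) = x) (hστ : ∀ x, σ (τ x) = τ (σ x))
    (hfix : ∀ z, σ (τ z) = z → τ z = z) (h2 : (2 : F) ≠ 0) {a b x : F} (ha : τ a = a)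
    (h : a * τ x + b * σ x + σ.symm b * σ.symm x = 0) : τ (b * x * σ x) = b * x * σ x := by
  have hs (y : F) : τ (σ.symm y) = σ.symm (τ y) := by
    rw [RingEquiv.eq_symm_apply, hστ, σ.apply_symm_apply]
  set u := b * x * σ x with hu
  have hsu : σ.symm u = σ.symm b * σ.symm x * x := by simp [hu]
  have h1 : a * (x * τ x) + u + σ.symm u = 0 := by rw [hsu]; linear_combination x * h
  have h3 : a * (x * τ x) + τ u + σ.symm (τ u) = 0 := by
    have := congrArg τ h1
    simp only [map_add, map_mul, hττ, ha, hs, map_zero] at this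
    linear_combination this
  set v := u - τ u with hv
  have h4 : v + σ.symm v = 0 := by rw [hv, map_sub]; linear_combination h1 - h3
  have h5 : σ v = -v := by
    have := congrArg σ h4
    rw [map_add, σ.apply_symm_apply, map_zero] at this
    linear_combination this
  have h6 : τ v = -v := by rw [hv, map_sub, hττ]; ring
  have h7 : τ v = v := hfix v (by rw [h6, map_neg, h5, neg_neg])
  have h8 : (2 : F) * v = 0 := by linear_combination h6 - h7
  have h9 : v = 0 := (mul_eq_zero.1 h8).resolve_left h2
  exact (sub_eq_zero.1 h9).symm

lemma twisted_zero_iff (hττ : ∀ x, τ (τ x) = x) (hστ : ∀ x, σ (τ x) = τ (σ x))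
    {a b u x : F} (hu : τ u = u) (hx : x ≠ 0) (ha : a * (x * τ x) = -(u + σ.symm u))
    (hb : b * x * σ x = u) (z : F) :
    a * τ (x * z) + b * σ (x * z) + σ.symm b * σ.symm (x * z) = 0
      ↔ σ (τ (u * (σ (τ z) - z))) = u * (σ (τ z) - z) := by
  have hsu : σ.symm b * σ.symm x * x = σ.symm u := by simp [← hb]
  have key : (a * τ (x * z) + b * σ (x * z) + σ.symm b * σ.symm (x * z)) * x
      = τ (u * (σ (τ z) - z)) - σ.symm (u * (σ (τ z) - z)) := by
    have hz : τ (σ (τ z)) = σ z := by rw [← hστ, hττ]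
    simp only [map_mul, map_sub, hz, σ.symm_apply_apply, hu]
    linear_combination τ z * ha + σ z * hb + σ.symm z * hsu
  rw [← RingEquiv.eq_symm_apply, ← sub_eq_zero (b := σ.symm _), ← key, mul_eq_zero,
    or_iff_left hx]

variable [Fintype F]

lemma card_twisted_zeros_iff (hττ : ∀ x, τ (τ x) = x) (hστ : ∀ x, σ (τ x) = τ (σ x))
    {a b x y : F} (hy : τ y = y) (hy0 : y ≠ 0) (hx : x ≠ 0)
    (ha : a * (x * τ x) = -(y⁻¹ + σ.symm y⁻¹)) (hb : b * x * σ x = y⁻¹) :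
    Finset.card {v | a * τ v + b * σ v + σ.symm b * σ.symm v = 0}
        = Finset.card {z | σ (τ z) = z} ↔ ∀ z, σ (τ z) - z ≠ y := by
  have hcard : Finset.card {v | a * τ v + b * σ v + σ.symm b * σ.symm v = 0}
      = Finset.card {z | σ (τ (y⁻¹ * (σ (τ z) - z))) = y⁻¹ * (σ (τ z) - z)} := by
    symm
    refine Finset.card_bij (fun z _ => x * z) ?_ (fun _ _ _ _ h => mul_left_cancel₀ hx h) ?_
    · intro z hz
      simp only [Finset.mem_filter_univ] at hz ⊢
      exact (twisted_zero_iff hττ hστ (by rw [map_inv₀, hy]) hx ha hb z).2 hz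
    · intro v hv
      have hv' : x * (x⁻¹ * v) = v := mul_inv_cancel_left₀ hx v
      simp only [Finset.mem_filter_univ] at hv
      rw [← hv'] at hv
      refine ⟨x⁻¹ * v, ?_, hv'⟩
      simpa only [Finset.mem_filter_univ] using
        (twisted_zero_iff hττ hστ (by rw [map_inv₀, hy]) hx ha hb _).1 hv
  rw [hcard]
  constructor
  · intro h z hz
    have hsub : Finset.filter (fun z => σ (τ z) = z) Finset.univ ⊆
        Finset.filter (fun z => σ (τ (y⁻¹ * (σ (τ z) - z))) = y⁻¹ * (σ (τ z) - z))
          Finset.univ := by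
      intro w hw
      simp only [Finset.mem_filter_univ] at hw ⊢
      simp [hw]
    have hmem : z ∈ Finset.filter (fun z => σ (τ z) = z) Finset.univ := by
      rw [Finset.eq_of_subset_of_card_le hsub h.le]
      rw [Finset.mem_filter_univ, hz, inv_mul_cancel₀ hy0, map_one, map_one]
    rw [Finset.mem_filter_univ] at hmem
    exact hy0 (by rw [← hz, hmem, sub_self])
  · intro h
    congr 1
    ext z
    simp only [Finset.mem_filter_univ]
    refine ⟨fun hz => ?_, fun hz => by simp [hz]⟩
    by_contra hne
    set c := y⁻¹ * (σ (τ z) - z) with hc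
    have hne' : σ (τ z) - z ≠ 0 := sub_ne_zero.2 hne
    have hc0 : c ≠ 0 := mul_ne_zero (inv_ne_zero hy0) hne'
    apply h (z / c)
    rw [map_div₀, map_div₀, hz, ← sub_div, div_eq_iff hc0, hc, mul_inv_cancel_left₀ hy0]

lemma card_fixed_range_mul_card_fixed (hττ : ∀ x, τ (τ x) = x)
    (hστ : ∀ x, σ (τ x) = τ (σ x)) (hfix : ∀ z, σ (τ z) = z → τ z = z) (h2 : (2 : F) ≠ 0) :
    Finset.card {y | τ y = y ∧ ∃ z, σ (τ z) - z = y} * Finset.card {z | σ (τ z) = z}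
      = Finset.card {y | τ y = y} := by
  rw [Finset.card_eq_sum_card_fiberwise (s := {y | τ y = y})
    (t := {y | τ y = y ∧ ∃ z, σ (τ z) - z = y}) (f := fun z => σ (τ z) - z), ← smul_eq_mul]
  · refine (Finset.sum_const_nat fun y hy => ?_).symm
    simp only [Finset.mem_filter_univ] at hy
    obtain ⟨hy, z₀, hz₀⟩ := hy
    have hz₀' : τ z₀ = z₀ := by
      have h1 : τ (σ (τ z₀)) = σ z₀ := by rw [← hστ, hττ]
      have h3 : σ z₀ - τ z₀ = y := by rw [← hy, ← hz₀, map_sub, h1]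
      have h4 := hfix (τ z₀ - z₀) (by
        rw [map_sub, hττ, map_sub]; linear_combination h3 - hz₀)
      rw [map_sub, hττ] at h4
      have h5 : 2 * (τ z₀ - z₀) = 0 := by linear_combination -h4
      exact sub_eq_zero.1 ((mul_eq_zero.1 h5).resolve_left h2)
    refine Finset.card_bij (fun z _ => z - z₀) ?_ (fun _ _ _ _ h => sub_left_injective h) ?_
    · intro z hz
      simp only [Finset.mem_filter, Finset.mem_univ, true_and, map_sub] at hz ⊢
      linear_combination hz.2 - hz₀
    · intro e he
      simp only [Finset.mem_filter_univ] at he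
      refine ⟨e + z₀, ?_, add_sub_cancel_right e z₀⟩
      simp only [Finset.mem_filter, Finset.mem_univ, true_and, map_add, hfix e he, hz₀']
      rw [hfix e he] at he
      rw [hz₀'] at hz₀
      linear_combination he + hz₀
  · intro z hz
    simp only [Finset.coe_filter, Finset.mem_univ, true_and, Set.mem_ofPred_eq] at hz ⊢
    exact ⟨by rw [map_sub, ← hστ, hz, hz], z, rfl⟩

lemma card_twisted_pairs_through (hττ : ∀ x, τ (τ x) = x) (hστ : ∀ x, σ (τ x) = τ (σ x))
    (hfix : ∀ z, σ (τ z) = z → τ z = z) (h2 : (2 : F) ≠ 0) {x : F} (hx : x ≠ 0) :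
    Finset.card {ab : F × F | (τ ab.1 = ab.1 ∧ ¬(ab.1 = 0 ∧ ab.2 = 0) ∧
        Finset.card {v | ab.1 * τ v + ab.2 * σ v + σ.symm ab.2 * σ.symm v = 0}
          = Finset.card {z | σ (τ z) = z}) ∧
        ab.1 * τ x + ab.2 * σ x + σ.symm ab.2 * σ.symm x = 0}
      = Finset.card {y | τ y = y ∧ ∀ z, σ (τ z) - z ≠ y} := by
  have hσx : σ x ≠ 0 := by simpa using hx
  have hτx : τ x ≠ 0 := by simpa using hx
  have hs (y : F) : τ (σ.symm y) = σ.symm (τ y) := by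
    rw [RingEquiv.eq_symm_apply, hστ, σ.apply_symm_apply]
  symm
  refine Finset.card_bij
    (fun y _ => (-(y⁻¹ + σ.symm y⁻¹) / (x * τ x), y⁻¹ / (x * σ x))) ?_ ?_ ?_
  · intro y hy
    simp only [Finset.mem_filter_univ] at hy ⊢
    obtain ⟨hy, hW⟩ := hy
    have hy0 : y ≠ 0 := fun h => hW 0 (by simp [h])
    have ha : -(y⁻¹ + σ.symm y⁻¹) / (x * τ x) * (x * τ x) = -(y⁻¹ + σ.symm y⁻¹) :=
      div_mul_cancel₀ _ (mul_ne_zero hx hτx)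
    have hb : y⁻¹ / (x * σ x) * x * σ x = y⁻¹ := by field_simp
    refine ⟨⟨?_, fun h => ?_, (card_twisted_zeros_iff hττ hστ hy hy0 hx ha hb).2 hW⟩, ?_⟩
    · simp only [map_div₀, map_neg, map_add, map_mul, map_inv₀, hs, hy, hττ]
      rw [mul_comm x]
    · exact div_ne_zero (inv_ne_zero hy0) (mul_ne_zero hx hσx) h.2
    · have := (twisted_zero_iff hττ hστ (by rw [map_inv₀, hy]) hx ha hb 1).2 (by simp)
      rwa [mul_one] at this
  · intro y _ y' _ h
    have h' := (Prod.mk.inj h).2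
    rwa [div_left_inj' (mul_ne_zero hx hσx), inv_inj] at h'
  · rintro ⟨a, b⟩ hab
    simp only [Finset.mem_filter_univ] at hab
    obtain ⟨⟨ha, hne, hcard⟩, h0⟩ := hab
    have hsu : σ.symm (b * x * σ x) = σ.symm b * σ.symm x * x := by simp
    have ha' : a * (x * τ x) = -(b * x * σ x + σ.symm (b * x * σ x)) := by
      rw [hsu]; linear_combination x * h0
    have hb0 : b ≠ 0 := by
      rintro rfl
      refine hne ⟨?_, rfl⟩
      simpa [hx] using h0
    have hu := fixed_of_twisted_zero hττ hστ hfix h2 ha h0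
    set u := b * x * σ x with hudef
    have hu0 : u ≠ 0 := mul_ne_zero (mul_ne_zero hb0 hx) hσx
    have hy : τ u⁻¹ = u⁻¹ := by rw [map_inv₀, hu]
    refine ⟨u⁻¹, ?_, ?_⟩
    · rw [Finset.mem_filter_univ]
      exact ⟨hy, (card_twisted_zeros_iff hττ hστ hy (inv_ne_zero hu0) hx
        (by rw [inv_inv]; exact ha') (by rw [inv_inv])).1 hcard⟩
    · rw [inv_inv, ← ha', mul_div_cancel_right₀ _ (mul_ne_zero hx hτx), hudef, mul_assoc b,
        mul_div_cancel_right₀ _ (mul_ne_zero hx hσx)]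

theorem card_twisted_pairs (hττ : ∀ x, τ (τ x) = x) (hστ : ∀ x, σ (τ x) = τ (σ x))
    (hfix : ∀ z, σ (τ z) = z → τ z = z) (h2 : (2 : F) ≠ 0) :
    Finset.card {ab : F × F | τ ab.1 = ab.1 ∧ ¬(ab.1 = 0 ∧ ab.2 = 0) ∧
        Finset.card {v | ab.1 * τ v + ab.2 * σ v + σ.symm ab.2 * σ.symm v = 0}
          = Finset.card {z | σ (τ z) = z}} * (Finset.card {z | σ (τ z) = z} - 1)
      = (Fintype.card F - 1) * Finset.card {y | τ y = y ∧ ∀ z, σ (τ z) - z ≠ y} := by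
  have hF : Finset.card (Finset.univ.erase (0 : F)) = Fintype.card F - 1 := by
    rw [Finset.card_erase_of_mem (Finset.mem_univ _), Finset.card_univ]
  rw [← hF]
  refine Finset.card_mul_eq_card_mul
    (fun (ab : F × F) x => ab.1 * τ x + ab.2 * σ x + σ.symm ab.2 * σ.symm x = 0) ?_ ?_
  · intro ab hab
    rw [Finset.mem_filter_univ] at hab
    rw [← hab.2.2, Finset.bipartiteAbove, Finset.filter_erase, Finset.card_erase_of_mem]
    simp
  · intro x hx
    rw [← card_twisted_pairs_through hττ hστ hfix h2 (Finset.ne_of_mem_erase hx),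
      Finset.bipartiteBelow, Finset.filter_filter]

end TwistedTrinomial

lemma card_frobenius_fixed {F : Type*} [Field F] [Fintype F] {p n j : ℕ} (hp : p.Prime)
    (hF : Fintype.card F = p ^ n) (hj : j ∣ n) :
    Finset.card {x : F | x ^ p ^ j = x} = p ^ j := by
  have hpos : 0 < p ^ j := pow_pos hp.pos j
  have hker : Nat.card (powMonoidHom (p ^ j - 1) : Fˣ →* Fˣ).ker = p ^ j - 1 := by
    rw [IsCyclic.card_powMonoidHom_ker, Nat.card_eq_fintype_card, Fintype.card_units, hF]
    exact Nat.gcd_eq_right (Nat.pow_sub_one_dvd_pow_sub_one p hj)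
  have hset : Finset.filter (fun x : F => x ^ p ^ j = x) Finset.univ
      = insert 0 (Finset.image (fun u : (powMonoidHom (p ^ j - 1) : Fˣ →* Fˣ).ker => ((u : Fˣ) : F))
        Finset.univ) := by
    ext x
    simp only [Finset.mem_filter_univ, Finset.mem_insert, Finset.mem_image, Finset.mem_univ,
      true_and]
    by_cases hx : x = 0
    · simp [hx, hp.ne_zero]
    · have hxp : x ^ p ^ j = x ^ (p ^ j - 1) * x := by rw [← pow_succ, Nat.sub_add_cancel hpos]
      rw [hxp, mul_eq_right₀ hx, or_iff_right hx]
      constructor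
      · intro h
        exact ⟨⟨Units.mk0 x hx, by rw [MonoidHom.mem_ker]; ext; simpa using h⟩, rfl⟩
      · rintro ⟨⟨u, hu⟩, rfl⟩
        rw [MonoidHom.mem_ker, powMonoidHom_apply] at hu
        rw [← Units.val_pow_eq_pow_val, hu, Units.val_one]
  rw [hset, Finset.card_insert_of_notMem (by simp), Finset.card_image_of_injective,
    Finset.card_univ, ← Nat.card_eq_fintype_card, hker, Nat.sub_add_cancel hpos]
  exact fun u v h => Subtype.ext (Units.ext h)

theorem stmt2 (p m k n d d' : ℕ) (hp : Nat.Prime p) (hodd : p % 2 = 1)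
    (hm : 0 < m) (hn : n = 2 * m) (hk : k ≤ n - 1) (hkm : k ≠ m)
    (hd : d = Nat.gcd m k) (hd' : d' = Nat.gcd (m + k) (2 * k))
    (F : Type) [Field F] [Fintype F] [Algebra (ZMod p) F] (hF : Fintype.card F = p ^ n) (s : ℕ) (hs : s = n / d)
    (hcase : d' = d) :
    Nat.card {ab : F × F // ab.1 ^ p ^ m = ab.1 ∧ ¬(ab.1 = 0 ∧ ab.2 = 0) ∧
        Nat.card {x : F // phiMap p m n k ab.1 ab.2 x = 0} = p ^ d}
      = p ^ (m - d) * (p ^ n - 1) := by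
  have : Fact p.Prime := ⟨hp⟩
  have : CharP F p := charP_of_injective_algebraMap (algebraMap (ZMod p) F).injective p
  have hkn : k ≤ n := hk.trans (Nat.sub_le _ _)
  have hq (x : F) : x ^ p ^ n = x := by rw [← hF]; exact FiniteField.pow_card x
  have hdm : d ∣ m := hd ▸ Nat.gcd_dvd_left m k
  have hmn : m ∣ n := hn ▸ Dvd.intro_left 2 rfl
  have hd0 : 0 < d := hd ▸ Nat.gcd_pos_of_pos_left k hm
  have h2 : (2 : F) ≠ 0 := Ring.two_ne_zero (by rw [ringChar.eq F p]; rintro rfl; omega)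
  let σ : F ≃+* F := iterateFrobeniusEquiv F p k
  let τ : F ≃+* F := iterateFrobeniusEquiv F p m
  have hσ (x : F) : σ x = x ^ p ^ k := rfl
  have hτ (x : F) : τ x = x ^ p ^ m := rfl
  have hσs (x : F) : σ.symm x = x ^ p ^ (n - k) := by
    rw [RingEquiv.symm_apply_eq, hσ, ← pow_mul, ← pow_add, Nat.sub_add_cancel hkn, hq]
  have hττ (x : F) : τ (τ x) = x := by
    rw [hτ, hτ, ← pow_mul, ← pow_add, ← two_mul, ← hn, hq]
  have hστ (x : F) : σ (τ x) = τ (σ x) := by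
    rw [hσ, hτ, hτ, hσ, ← pow_mul, ← pow_mul, mul_comm]
  have hgcd : Nat.gcd (m + k) n = d := by
    rw [← hcase, hd', show n = 2 * m from hn]
    apply Nat.dvd_antisymm
    · refine Nat.dvd_gcd (Nat.gcd_dvd_left _ _) ((Nat.dvd_add_right (Nat.gcd_dvd_right _ _)).1 ?_)
      rw [← mul_add]
      exact (Nat.gcd_dvd_left _ _).mul_left 2
    · refine Nat.dvd_gcd (Nat.gcd_dvd_left _ _) ((Nat.dvd_add_left (Nat.gcd_dvd_right _ _)).1 ?_)
      rw [← mul_add]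
      exact (Nat.gcd_dvd_left _ _).mul_left 2
  have hper (j : ℕ) (x : F) : Function.IsPeriodicPt (frobenius F p) j x ↔ x ^ p ^ j = x := by
    rw [Function.IsPeriodicPt, Function.IsFixedPt, iterate_frobenius]
  have hEiff (z : F) : σ (τ z) = z ↔ z ^ p ^ d = z := by
    rw [hσ, hτ, ← pow_mul, ← pow_add]
    refine ⟨fun h => ?_, fun h => ?_⟩
    · rw [← hper, ← hgcd]
      exact ((hper _ _).2 h).gcd ((hper _ _).2 (hq z))
    · rw [← hper] at h ⊢
      exact h.trans_dvd (hgcd ▸ Nat.gcd_dvd_left _ _)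
  have hfix (z : F) (hz : σ (τ z) = z) : τ z = z :=
    (hper m z).1 (((hper d z).2 ((hEiff z).1 hz)).trans_dvd hdm)
  have hE : Finset.card {z | σ (τ z) = z} = p ^ d := by
    simp only [hEiff]
    exact card_frobenius_fixed hp hF (hdm.trans hmn)
  have hK : Finset.card {y | τ y = y} = p ^ m := by
    simp only [hτ]
    exact card_frobenius_fixed hp hF hmn
  have hW : Finset.card {y | τ y = y ∧ ∃ z, σ (τ z) - z = y} = p ^ (m - d) := by
    have h := card_fixed_range_mul_card_fixed hττ hστ hfix h2
    rw [hE, hK, ← Nat.sub_add_cancel (Nat.le_of_dvd hm hdm), pow_add] at h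
    exact Nat.eq_of_mul_eq_mul_right (pow_pos hp.pos d) h
  have hKW : Finset.card {y | τ y = y ∧ ∀ z, σ (τ z) - z ≠ y} = p ^ (m - d) * (p ^ d - 1) := by
    have h := Finset.card_filter_add_card_filter_not (s := {y | τ y = y})
      (fun y => ∃ z, σ (τ z) - z = y)
    rw [Finset.filter_filter, Finset.filter_filter, hW, hK] at h
    simp only [not_exists] at h
    rw [Nat.mul_sub, mul_one, ← pow_add, Nat.sub_add_cancel (Nat.le_of_dvd hm hdm), ← h,
      Nat.add_sub_cancel_left]
  have hmain := card_twisted_pairs hττ hστ hfix h2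
  rw [hE, hKW, hF, ← mul_assoc] at hmain
  have hpd : 0 < p ^ d - 1 := Nat.sub_pos_of_lt (Nat.one_lt_pow hd0.ne' hp.one_lt)
  have hfinal := Nat.eq_of_mul_eq_mul_right hpd hmain
  rw [mul_comm (p ^ (m - d)), ← hfinal, Nat.card_eq_fintype_card, Fintype.card_subtype]
  simp only [phiMap, Nat.card_eq_fintype_card, Fintype.card_subtype, hσs, hσ, hτ]
end
end

section
/- The sum of T(α,β)^2 over all α ∈ F_{p^m} and β ∈ F_q equals: p^{3m} if d' = d and p^d ≡ 3 (mod 4); (2p^n − 1)·p^{3m} if d' = d and p^d ≡ 1 (mod 4); and (p^{n+d} + p^n − p^d)·p^{3m} if d' = 2d. -/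
open scoped BigOperators Classical

noncomputable section

section TraceCharacter

variable {p : ℕ} {F : Type} [Field F]

theorem trSum_add [Fact p.Prime] [CharP F p] (t r : ℕ) (x y : F) :
    trSum p t r (x + y) = trSum p t r x + trSum p t r y := by
  simp only [trSum, add_pow_char_pow, Finset.sum_add_distrib]

theorem trSum_one_pow_char [Fact p.Prime] [CharP F p] {r : ℕ} {a : F} (ha : a ^ p ^ r = a) :
    trSum p 1 r a ^ p = trSum p 1 r a := by
  have h₁ := Finset.sum_range_succ (fun i => a ^ p ^ i) r
  have h₂ := Finset.sum_range_succ' (fun i => a ^ p ^ i) r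
  simp only [trSum, one_mul, sum_pow_char, ← pow_mul, ← pow_succ]
  simp only [pow_zero, pow_one, ha] at h₁ h₂
  exact add_right_cancel (h₂.symm.trans h₁)

theorem exists_algebraMap_eq_of_pow_char_eq_self [Fact p.Prime] [Algebra (ZMod p) F] {x : F}
    (hx : x ^ p = x) : ∃ c : ZMod p, algebraMap (ZMod p) F c = x := by
  have : CharP F p := charP_of_injective_algebraMap (algebraMap (ZMod p) F).injective p
  have h := (Subfield.mem_bot_iff_pow_eq_self F p).2 hx
  rw [← ZMod.fieldRange_castHom_eq_bot p, RingHom.mem_fieldRange] at h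
  obtain ⟨c, hc⟩ := h
  exact ⟨c, by rw [← hc]; congr 1; exact Subsingleton.elim _ _⟩

theorem fToZMod_algebraMap [Fact p.Prime] [Algebra (ZMod p) F] (c : ZMod p) :
    fToZMod p (algebraMap (ZMod p) F c) = c :=
  Function.leftInverse_invFun (algebraMap (ZMod p) F).injective c

theorem expChar_eq_stdAddChar [NeZero p] (c : ZMod p) : expChar p c = ZMod.stdAddChar c := by
  have h := ZMod.stdAddChar_coe (N := p) (c.val : ℤ)
  rw [Int.cast_natCast, ZMod.natCast_zmod_val] at h
  rw [h, expChar, Int.cast_natCast]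

theorem expChar_add [NeZero p] (a b : ZMod p) : expChar p (a + b) = expChar p a * expChar p b := by
  simp only [expChar_eq_stdAddChar, AddChar.map_add_eq_mul]

/-- The additive character `ζ_p^{Tr(a)}` of the subfield `{a : a ^ p ^ r = a}`. -/
def traceChar (p r : ℕ) [Algebra (ZMod p) F] (a : F) : ℂ :=
  expChar p (fToZMod p (trSum p 1 r a))

theorem traceChar_add [Fact p.Prime] [Algebra (ZMod p) F] {r : ℕ} {a b : F}
    (ha : a ^ p ^ r = a) (hb : b ^ p ^ r = b) :
    traceChar p r (a + b) = traceChar p r a * traceChar p r b := by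
  have : CharP F p := charP_of_injective_algebraMap (algebraMap (ZMod p) F).injective p
  obtain ⟨c, hc⟩ := exists_algebraMap_eq_of_pow_char_eq_self (trSum_one_pow_char ha)
  obtain ⟨e, he⟩ := exists_algebraMap_eq_of_pow_char_eq_self (trSum_one_pow_char hb)
  simp only [traceChar, trSum_add, ← hc, ← he, ← map_add, fToZMod_algebraMap, expChar_add]

theorem traceChar_zero [Fact p.Prime] [Algebra (ZMod p) F] (r : ℕ) :
    traceChar p r (0 : F) = 1 := by
  have hp := (Fact.out : p.Prime).ne_zero
  have h : trSum p 1 r (0 : F) = algebraMap (ZMod p) F 0 := by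
    simp [trSum, hp]
  rw [traceChar, h, fToZMod_algebraMap, expChar_eq_stdAddChar, AddChar.map_zero_eq_one]

theorem exists_trSum_ne_zero [Fact p.Prime] [Fintype F] {r : ℕ} (hr : 0 < r)
    (hcard : (Finset.univ.filter fun a : F => a ^ p ^ r = a).card = p ^ r) :
    ∃ a : F, a ^ p ^ r = a ∧ trSum p 1 r a ≠ 0 := by
  by_contra! h
  have hp := (Fact.out : p.Prime)
  let P : Polynomial F := ∑ i ∈ Finset.range r, Polynomial.X ^ p ^ i
  have hcoeff : P.coeff 1 = 1 := by
    simp only [P, Polynomial.finsetSum_coeff, Polynomial.coeff_X_pow]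
    rw [Finset.sum_eq_single 0]
    · simp
    · intro i _ hi
      exact if_neg (Nat.one_lt_pow hi hp.one_lt).ne
    · simp [hr.ne']
  have hP : P ≠ 0 := fun h0 => by simp [h0] at hcoeff
  have hdeg : P.natDegree ≤ p ^ (r - 1) := by
    refine Polynomial.natDegree_sum_le_of_forall_le _ _ fun i hi => ?_
    rw [Polynomial.natDegree_X_pow]
    exact Nat.pow_le_pow_right hp.pos (Nat.le_sub_one_of_lt (Finset.mem_range.1 hi))
  have hsub : (Finset.univ.filter fun a : F => a ^ p ^ r = a) ⊆ P.roots.toFinset := by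
    intro a ha
    rw [Multiset.mem_toFinset, Polynomial.mem_roots hP]
    have := h a (Finset.mem_filter.1 ha).2
    simpa [P, Polynomial.IsRoot, Polynomial.eval_finsetSum, trSum] using this
  have hle := (Finset.card_le_card hsub).trans ((Multiset.toFinset_card_le _).trans P.card_roots')
  rw [hcard] at hle
  exact absurd (hle.trans hdeg) (not_le.2 (Nat.pow_lt_pow_right hp.one_lt (by omega)))

theorem exists_traceChar_ne_one [Fact p.Prime] [Algebra (ZMod p) F] [Fintype F] {r : ℕ}
    (hr : 0 < r) (hcard : (Finset.univ.filter fun a : F => a ^ p ^ r = a).card = p ^ r) :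
    ∃ a : F, a ^ p ^ r = a ∧ traceChar p r a ≠ 1 := by
  have : CharP F p := charP_of_injective_algebraMap (algebraMap (ZMod p) F).injective p
  obtain ⟨a, ha, h0⟩ := exists_trSum_ne_zero hr hcard
  refine ⟨a, ha, fun h1 => h0 ?_⟩
  obtain ⟨c, hc⟩ := exists_algebraMap_eq_of_pow_char_eq_self (trSum_one_pow_char ha)
  rw [traceChar, ← hc, fToZMod_algebraMap, expChar_eq_stdAddChar,
    ← AddChar.map_zero_eq_one (ZMod.stdAddChar (N := p))] at h1
  rw [← hc, ZMod.injective_stdAddChar h1, map_zero]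

theorem sum_traceChar_mul [Fact p.Prime] [Algebra (ZMod p) F] [Fintype F] {r : ℕ}
    (hr : 0 < r) (hcard : (Finset.univ.filter fun a : F => a ^ p ^ r = a).card = p ^ r)
    {c : F} (hc : c ^ p ^ r = c) :
    ∑ a ∈ Finset.univ.filter (fun a : F => a ^ p ^ r = a), traceChar p r (a * c)
      = if c = 0 then (p : ℂ) ^ r else 0 := by
  have : CharP F p := charP_of_injective_algebraMap (algebraMap (ZMod p) F).injective p
  split_ifs with h
  · simp [h, traceChar_zero, hcard]
  · obtain ⟨b, hb, hb1⟩ := exists_traceChar_ne_one hr hcard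
    have hbc : (b / c) ^ p ^ r = b / c := by rw [div_pow, hb, hc]
    set S := ∑ a ∈ Finset.univ.filter (fun a : F => a ^ p ^ r = a), traceChar p r (a * c) with hS
    have key : S = traceChar p r b * S := by
      conv_lhs => rw [hS]
      rw [hS, Finset.mul_sum]
      symm
      refine Finset.sum_bij (fun a _ => a + b / c) ?_ ?_ ?_ ?_
      · intro a ha
        simp only [Finset.mem_filter, Finset.mem_univ, true_and] at ha ⊢
        rw [add_pow_char_pow, ha, hbc]
      · intro a _ a' _ h'
        exact add_right_cancel h'
      · intro a ha
        simp only [Finset.mem_filter, Finset.mem_univ, true_and] at ha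
        refine ⟨a - b / c, ?_, sub_add_cancel _ _⟩
        simp only [Finset.mem_filter, Finset.mem_univ, true_and]
        rw [sub_pow_char_pow, ha, hbc]
      · intro a ha
        simp only [Finset.mem_filter, Finset.mem_univ, true_and] at ha
        rw [add_mul, div_mul_cancel₀ _ h, mul_comm (traceChar p r b),
          traceChar_add (by rw [mul_pow, ha, hc]) hb]
    have : (1 - traceChar p r b) * S = 0 := by rw [sub_mul, one_mul, ← key, sub_self]
    exact (mul_eq_zero.1 this).resolve_left (sub_ne_zero.2 (Ne.symm hb1))

end TraceCharacter

section FiniteFieldCounting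

variable {F : Type} [Field F] [Fintype F]

theorem exists_isPrimitiveRoot_of_dvd_card_sub_one {e : ℕ} (he : e ∣ Fintype.card F - 1) :
    ∃ ζ : F, IsPrimitiveRoot ζ e := by
  have hpos : 0 < Fintype.card F - 1 := Nat.sub_pos_of_lt Fintype.one_lt_card
  obtain ⟨g, hg⟩ := IsCyclic.exists_generator (α := Fˣ)
  have ho : orderOf g = Fintype.card F - 1 := by
    rw [orderOf_eq_card_of_forall_mem_zpowers hg, Nat.card_eq_fintype_card, Fintype.card_units]
  have hprim : IsPrimitiveRoot g (Fintype.card F - 1) := ho ▸ IsPrimitiveRoot.orderOf g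
  obtain ⟨c, hc⟩ := he
  exact ⟨_, (IsPrimitiveRoot.coe_units_iff.2 hprim).pow hpos (hc.trans (mul_comm _ _))⟩

theorem card_filter_pow_eq {e : ℕ} (he : e ∣ Fintype.card F - 1) {a : F} (ha : a ≠ 0)
    (h : ∃ z : F, z ^ e = a) : (Finset.univ.filter fun z : F => z ^ e = a).card = e := by
  have hpos : 0 < Fintype.card F - 1 := Nat.sub_pos_of_lt Fintype.one_lt_card
  obtain ⟨ζ, hζ⟩ := exists_isPrimitiveRoot_of_dvd_card_sub_one he
  have heq : (Finset.univ.filter fun z : F => z ^ e = a) = (Polynomial.nthRoots e a).toFinset := by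
    ext z
    simp [Polynomial.mem_nthRoots (Nat.pos_of_dvd_of_pos he hpos)]
  rw [heq, Multiset.toFinset_card_of_nodup (hζ.nthRoots_nodup ha), hζ.card_nthRoots, if_pos h]

theorem card_filter_pow_eq_self {r : ℕ} (hr : 1 < r) (h : r - 1 ∣ Fintype.card F - 1) :
    (Finset.univ.filter fun a : F => a ^ r = a).card = r := by
  have heq : (Finset.univ.filter fun a : F => a ^ r = a)
      = insert 0 (Finset.univ.filter fun a : F => a ^ (r - 1) = 1) := by
    ext a
    obtain ⟨s, rfl⟩ : ∃ s, r = s + 1 := ⟨r - 1, by omega⟩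
    have hs : s ≠ 0 := by omega
    by_cases ha : a = 0
    · simp [ha]
    · simp [ha, pow_succ]
  rw [heq, Finset.card_insert_of_notMem, card_filter_pow_eq h one_ne_zero ⟨1, one_pow _⟩]
  · omega
  · simp [show r - 1 ≠ 0 by omega]

theorem card_filter_pow_eq_neg_one {e : ℕ} (he : 2 * e ∣ Fintype.card F - 1) :
    (Finset.univ.filter fun z : F => z ^ e = -1).card = e := by
  have hpos : 0 < Fintype.card F - 1 := Nat.sub_pos_of_lt Fintype.one_lt_card
  refine card_filter_pow_eq ((Dvd.intro_left 2 rfl).trans he) (neg_ne_zero.2 one_ne_zero) ?_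
  obtain ⟨ζ, hζ⟩ := exists_isPrimitiveRoot_of_dvd_card_sub_one he
  exact ⟨ζ, (hζ.pow (Nat.pos_of_dvd_of_pos he hpos) (mul_comm _ _)).eq_neg_one_of_two_right⟩

/-- Solutions of `x ^ a + y ^ a = x ^ b + y ^ b = 0` are `(0, 0)` and the pairs `(x, x z)` with
`x ≠ 0` and `z ^ a = z ^ b = -1`. -/
theorem card_filter_pow_add_pow_eq_zero {a b : ℕ} (ha : a ≠ 0) (hb : b ≠ 0) :
    (Finset.univ.filter fun w : F × F =>
        w.1 ^ a + w.2 ^ a = 0 ∧ w.1 ^ b + w.2 ^ b = 0).card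
      = 1 + (Fintype.card F - 1) *
        (Finset.univ.filter fun z : F => z ^ a = -1 ∧ z ^ b = -1).card := by
  have hunits : (Finset.univ.filter fun x : F => x ≠ 0).card = Fintype.card F - 1 := by
    rw [Finset.filter_ne', Finset.card_erase_of_mem (Finset.mem_univ _), Finset.card_univ]
  have heq : (Finset.univ.filter fun w : F × F =>
        w.1 ^ a + w.2 ^ a = 0 ∧ w.1 ^ b + w.2 ^ b = 0)
      = insert (0, 0) (((Finset.univ.filter fun x : F => x ≠ 0) ×ˢ
        (Finset.univ.filter fun z : F => z ^ a = -1 ∧ z ^ b = -1)).image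
          fun w => (w.1, w.1 * w.2)) := by
    ext ⟨x, y⟩
    simp only [Finset.mem_filter, Finset.mem_univ, true_and, Finset.mem_insert, Finset.mem_image,
      Finset.mem_product, Prod.mk.injEq, Prod.exists]
    constructor
    · rintro ⟨h₁, h₂⟩
      by_cases hx : x = 0
      · subst hx
        left
        simpa [ha] using h₁
      · refine Or.inr ⟨x, y / x, ⟨hx, ?_, ?_⟩, rfl, mul_div_cancel₀ y hx⟩
        · rw [div_pow, div_eq_iff (pow_ne_zero _ hx)]
          linear_combination h₁
        · rw [div_pow, div_eq_iff (pow_ne_zero _ hx)]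
          linear_combination h₂
    · rintro (⟨rfl, rfl⟩ | ⟨x', z, ⟨_, h₁, h₂⟩, rfl, rfl⟩)
      · simp [ha, hb]
      · simp [mul_pow, h₁, h₂]
  rw [heq, Finset.card_insert_of_notMem, Finset.card_image_of_injOn, Finset.card_product, hunits,
    add_comm]
  · rintro ⟨x, z⟩ hw ⟨x', z'⟩ _ h
    simp only [Finset.coe_product, Set.mem_prod, Finset.coe_filter, Finset.mem_univ, true_and,
      Set.mem_ofPred_eq] at hw
    simp only [Prod.mk.injEq] at h
    obtain ⟨rfl, h⟩ := h
    rw [mul_left_cancel₀ hw.1 h]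
  · simp only [Finset.mem_image, Finset.mem_product, Finset.mem_filter, Finset.mem_univ, true_and,
      Prod.mk.injEq, Prod.exists, not_exists, not_and]
    rintro x z ⟨hx, -⟩ h
    exact absurd h hx

end FiniteFieldCounting

section SecondMoment

variable {p m n k : ℕ} {F : Type} [Field F] [Fintype F]

theorem card_filter_pow_prime_pow_eq_self [Fact p.Prime] (hF : Fintype.card F = p ^ n) {r : ℕ}
    (hr : 0 < r) (hrn : r ∣ n) :
    (Finset.univ.filter fun a : F => a ^ p ^ r = a).card = p ^ r := by
  refine card_filter_pow_eq_self (Nat.one_lt_pow hr.ne' (Fact.out : p.Prime).one_lt) ?_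
  rw [hF]
  exact Nat.pow_sub_one_dvd_pow_sub_one p hrn

theorem Tsum_eq_sum_traceChar_mul [NeZero p] [Algebra (ZMod p) F] (α β : F) :
    Tsum p m n k F α β = ∑ x : F, traceChar p m (α * x ^ (p ^ m + 1)) *
      traceChar p n (β * x ^ (p ^ k + 1)) := by
  simp only [Tsum, expChar_add, traceChar]

theorem pow_prime_pow_add_one_fixed (hn : n = 2 * m) (hF : Fintype.card F = p ^ n) (x : F) :
    (x ^ (p ^ m + 1)) ^ p ^ m = x ^ (p ^ m + 1) := by
  have h : x ^ p ^ (m + m) = x := by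
    rw [← two_mul, ← hn, ← hF, FiniteField.pow_card]
  rw [← pow_mul, add_mul, one_mul, ← pow_add, pow_add, h, pow_succ, mul_comm]

theorem sum_Tsum_sq [Fact p.Prime] [Algebra (ZMod p) F] (hm : 0 < m) (hn : n = 2 * m)
    (hF : Fintype.card F = p ^ n) :
    ∑ α : {a : F // a ^ p ^ m = a}, ∑ β : F, (Tsum p m n k F α.1 β) ^ 2
      = (1 + ((p : ℂ) ^ n - 1) * ((Finset.univ.filter fun z : F =>
          z ^ (p ^ m + 1) = -1 ∧ z ^ (p ^ k + 1) = -1).card : ℂ)) * (p : ℂ) ^ (3 * m) := by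
  have hp := (Fact.out : p.Prime)
  have : CharP F p := charP_of_injective_algebraMap (algebraMap (ZMod p) F).injective p
  have hfull : ∀ x : F, x ^ p ^ n = x := fun x => by rw [← hF, FiniteField.pow_card]
  have hcard : ((Finset.univ.filter fun w : F × F => w.1 ^ (p ^ m + 1) + w.2 ^ (p ^ m + 1) = 0 ∧
      w.1 ^ (p ^ k + 1) + w.2 ^ (p ^ k + 1) = 0).card : ℂ)
      = 1 + ((p : ℂ) ^ n - 1) * ((Finset.univ.filter fun z : F =>
          z ^ (p ^ m + 1) = -1 ∧ z ^ (p ^ k + 1) = -1).card : ℂ) := by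
    rw [card_filter_pow_add_pow_eq_zero (Nat.succ_ne_zero _) (Nat.succ_ne_zero _), hF]
    push_cast [Nat.cast_sub (Nat.one_le_pow n p hp.pos)]
    ring
  have hsub := fun c : F => fun hc => sum_traceChar_mul (c := c) hm
    (card_filter_pow_prime_pow_eq_self hF hm (hn ▸ Dvd.intro_left 2 rfl)) hc
  have hall := fun c : F => sum_traceChar_mul (c := c) (by omega)
    (card_filter_pow_prime_pow_eq_self hF (by omega) dvd_rfl) (hfull c)
  simp only [hfull, Finset.filter_true] at hall
  have hsq : ∀ α : {a : F // a ^ p ^ m = a}, ∀ β : F, (Tsum p m n k F α.1 β) ^ 2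
      = ∑ w : F × F, traceChar p m (α.1 * (w.1 ^ (p ^ m + 1) + w.2 ^ (p ^ m + 1))) *
        traceChar p n (β * (w.1 ^ (p ^ k + 1) + w.2 ^ (p ^ k + 1))) := by
    intro α β
    have hα : ∀ x : F, (α.1 * x ^ (p ^ m + 1)) ^ p ^ m = α.1 * x ^ (p ^ m + 1) := fun x => by
      rw [mul_pow, α.2, pow_prime_pow_add_one_fixed hn hF]
    rw [Tsum_eq_sum_traceChar_mul, sq, Finset.sum_mul_sum, Fintype.sum_prod_type]
    refine Finset.sum_congr rfl fun x _ => Finset.sum_congr rfl fun y _ => ?_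
    rw [mul_add, mul_add, traceChar_add (hα x) (hα y), traceChar_add (hfull _) (hfull _)]
    ring
  calc ∑ α : {a : F // a ^ p ^ m = a}, ∑ β : F, (Tsum p m n k F α.1 β) ^ 2
      = ∑ w : F × F,
          (∑ α : {a : F // a ^ p ^ m = a},
            traceChar p m (α.1 * (w.1 ^ (p ^ m + 1) + w.2 ^ (p ^ m + 1)))) *
          ∑ β : F, traceChar p n (β * (w.1 ^ (p ^ k + 1) + w.2 ^ (p ^ k + 1))) := by
        simp only [hsq, Finset.sum_mul_sum]
        rw [Finset.sum_comm]
        simp_rw [Finset.sum_comm (s := (Finset.univ : Finset {a : F // a ^ p ^ m = a}))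
          (t := (Finset.univ : Finset (F × F)))]
        rw [Finset.sum_comm]
        exact Finset.sum_congr rfl fun _ _ => Finset.sum_comm
    _ = ∑ w : F × F, if w.1 ^ (p ^ m + 1) + w.2 ^ (p ^ m + 1) = 0 ∧
          w.1 ^ (p ^ k + 1) + w.2 ^ (p ^ k + 1) = 0 then (p : ℂ) ^ (3 * m) else 0 := by
        refine Finset.sum_congr rfl fun w _ => ?_
        rw [hall, ← Finset.sum_subtype (Finset.univ.filter fun a : F => a ^ p ^ m = a) (by simp)
          (fun a => traceChar p m (a * (w.1 ^ (p ^ m + 1) + w.2 ^ (p ^ m + 1)))), hsub _ (by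
            rw [add_pow_char_pow, pow_prime_pow_add_one_fixed hn hF,
              pow_prime_pow_add_one_fixed hn hF]), ite_zero_mul_ite_zero, ← pow_add,
          show m + n = 3 * m by omega]
    _ = _ := by
        rw [← Finset.sum_filter, Finset.sum_const, nsmul_eq_mul, hcard]

end SecondMoment

section NegOneRoots

variable {p m n k : ℕ} {F : Type} [Field F]

theorem pow_prime_pow_gcd_eq_self [ExpChar F p] {a b : ℕ} {z : F} (ha : z ^ p ^ a = z)
    (hb : z ^ p ^ b = z) : z ^ p ^ Nat.gcd a b = z := by
  have h : ∀ r, Function.IsPeriodicPt (frobenius F p) r z ↔ z ^ p ^ r = z := fun r => by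
    rw [Function.IsPeriodicPt, Function.IsFixedPt, iterate_frobenius]
  exact (h _).1 (((h _).2 ha).gcd ((h _).2 hb))

theorem pow_prime_pow_mul_eq_self {d : ℕ} {z : F} (hd : z ^ p ^ d = z) (j : ℕ) :
    z ^ p ^ (d * j) = z := by
  induction j with
  | zero => simp
  | succ j ih => rw [Nat.mul_succ, pow_add, pow_mul, ih, hd]

theorem pow_prime_pow_add_eq_self (hodd : Odd p) {a b : ℕ} {z : F}
    (ha : z ^ (p ^ a + 1) = -1) (hb : z ^ (p ^ b + 1) = -1) : z ^ p ^ (a + b) = z := by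
  have hz : z ≠ 0 := by
    rintro rfl
    simp at ha
  have h₁ : (z ^ p ^ a * z) ^ p ^ b = -1 := by
    rw [← pow_succ, ha, (hodd.pow).neg_one_pow]
  rw [mul_pow, ← pow_mul z, ← pow_add p] at h₁
  rw [pow_succ] at hb
  have hzb : z ^ p ^ b ≠ 0 := pow_ne_zero _ hz
  apply mul_right_cancel₀ hzb
  rw [h₁, ← hb, mul_comm]

theorem pow_prime_pow_gcd_add_eq_self [ExpChar F p] (hodd : Odd p) {z : F}
    (hm : z ^ (p ^ m + 1) = -1) (hk : z ^ (p ^ k + 1) = -1) :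
    z ^ p ^ Nat.gcd (m + k) (2 * k) = z :=
  pow_prime_pow_gcd_eq_self (pow_prime_pow_add_eq_self hodd hm hk)
    (by rw [two_mul]; exact pow_prime_pow_add_eq_self hodd hk hk)

theorem pow_eq_neg_one_iff_of_gcd_eq [ExpChar F p] (hodd : Odd p)
    (h : Nat.gcd (m + k) (2 * k) = Nat.gcd m k) (z : F) :
    (z ^ (p ^ m + 1) = -1 ∧ z ^ (p ^ k + 1) = -1) ↔ z ^ p ^ Nat.gcd m k = z ∧ z ^ 2 = -1 := by
  have key : z ^ p ^ Nat.gcd m k = z → z ^ p ^ m = z ∧ z ^ p ^ k = z := fun hz =>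
    ⟨by obtain ⟨j, hj⟩ := Nat.gcd_dvd_left m k
        conv_lhs => rw [hj]
        exact pow_prime_pow_mul_eq_self hz j,
      by obtain ⟨j, hj⟩ := Nat.gcd_dvd_right m k
         conv_lhs => rw [hj]
         exact pow_prime_pow_mul_eq_self hz j⟩
  constructor
  · rintro ⟨h₁, h₂⟩
    have hz := h ▸ pow_prime_pow_gcd_add_eq_self hodd h₁ h₂
    refine ⟨hz, ?_⟩
    rwa [pow_succ, (key hz).1, ← sq] at h₁
  · rintro ⟨hz, h₂⟩
    rw [pow_succ, pow_succ, (key hz).1, (key hz).2, ← sq]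
    exact ⟨h₂, h₂⟩

theorem pow_eq_neg_one_iff_of_gcd_eq_two_mul [ExpChar F p] (hodd : Odd p) (hm : 0 < m)
    (h : Nat.gcd (m + k) (2 * k) = 2 * Nat.gcd m k) (z : F) :
    (z ^ (p ^ m + 1) = -1 ∧ z ^ (p ^ k + 1) = -1) ↔ z ^ (p ^ Nat.gcd m k + 1) = -1 := by
  set d := Nat.gcd m k with hd
  have hdpos : 0 < d := Nat.gcd_pos_of_pos_left _ hm
  obtain ⟨a, ha⟩ : d ∣ m := Nat.gcd_dvd_left m k
  obtain ⟨b, hb⟩ : d ∣ k := Nat.gcd_dvd_right m k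
  have hab : 2 ∣ a + b := by
    have h2 : d * 2 ∣ d * (a + b) := by
      rw [mul_comm d 2, ← h, mul_add, ← ha, ← hb]
      exact Nat.gcd_dvd_left _ _
    exact (Nat.mul_dvd_mul_iff_left hdpos).1 h2
  have hcop : Nat.gcd a b = 1 := by
    have h3 : d * Nat.gcd a b = d * 1 := by
      rw [← Nat.gcd_mul_left, ← ha, ← hb, mul_one]
    exact Nat.eq_of_mul_eq_mul_left hdpos h3
  have hodd_a : ¬ 2 ∣ a := fun h2 => by
    have := Nat.dvd_gcd h2 ((Nat.dvd_add_right h2).1 hab)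
    omega
  obtain ⟨i, hi⟩ : ∃ i, a = 2 * i + 1 := ⟨a / 2, by omega⟩
  obtain ⟨j, hj⟩ : ∃ j, b = 2 * j + 1 := ⟨b / 2, by omega⟩
  have hmd : m = 2 * d * i + d := by rw [ha, hi]; ring
  have hkd : k = 2 * d * j + d := by rw [hb, hj]; ring
  have key : ∀ s, z ^ p ^ (2 * d) = z → z ^ p ^ (2 * d * s + d) = z ^ p ^ d := fun s hz => by
    rw [pow_add, pow_mul, pow_prime_pow_mul_eq_self hz]
  constructor
  · rintro ⟨h₁, h₂⟩
    have hz := h ▸ pow_prime_pow_gcd_add_eq_self hodd h₁ h₂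
    rwa [pow_succ, hmd, key i hz, ← pow_succ] at h₁
  · intro h₁
    have hz : z ^ p ^ (2 * d) = z := by
      rw [two_mul]
      exact pow_prime_pow_add_eq_self hodd h₁ h₁
    have hm' : z ^ p ^ m = z ^ p ^ d := by conv_lhs => rw [hmd, key i hz]
    have hk' : z ^ p ^ k = z ^ p ^ d := by conv_lhs => rw [hkd, key j hz]
    rw [pow_succ, pow_succ, hm', hk', ← pow_succ]
    exact ⟨h₁, h₁⟩

theorem pow_eq_neg_of_mod_four_eq_three {r : ℕ} (hr : r % 4 = 3) {z : F} (hz : z ^ 2 = -1) :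
    z ^ r = -z := by
  obtain ⟨s, hs⟩ : ∃ s, r = 2 * (2 * s + 1) + 1 := ⟨r / 4, by omega⟩
  rw [hs, pow_succ, pow_mul, hz, pow_succ, pow_mul]
  simp

theorem pow_eq_self_of_mod_four_eq_one {r : ℕ} (hr : r % 4 = 1) {z : F} (hz : z ^ 2 = -1) :
    z ^ r = z := by
  obtain ⟨s, hs⟩ : ∃ s, r = 2 * (2 * s) + 1 := ⟨r / 4, by omega⟩
  rw [hs, pow_succ, pow_mul, hz, pow_mul]
  simp

theorem four_dvd_pow_two_mul_sub_one (hodd : Odd p) (m : ℕ) : 4 ∣ p ^ (2 * m) - 1 := by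
  obtain ⟨s, hs⟩ := hodd.pow (n := m)
  refine ⟨s * s + s, ?_⟩
  rw [mul_comm, pow_mul, hs]
  exact Nat.sub_eq_of_eq_add (by ring)

theorem two_mul_pow_add_one_dvd (hodd : Odd p) {d : ℕ} (hd : d ∣ m) :
    2 * (p ^ d + 1) ∣ p ^ (2 * m) - 1 := by
  refine Dvd.dvd.trans ?_ (Nat.pow_sub_one_dvd_pow_sub_one p (Nat.mul_dvd_mul_left 2 hd))
  obtain ⟨s, hs⟩ := hodd.pow (n := d)
  refine ⟨s, ?_⟩
  rw [mul_comm 2 d, pow_mul, hs]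
  exact Nat.sub_eq_of_eq_add (by ring)

end NegOneRoots

theorem stmt4 (p m k n d d' : ℕ) (hp : Nat.Prime p) (hodd : p % 2 = 1)
    (hm : 0 < m) (hn : n = 2 * m) (hk : k ≤ n - 1) (hkm : k ≠ m)
    (hd : d = Nat.gcd m k) (hd' : d' = Nat.gcd (m + k) (2 * k))
    (F : Type) [Field F] [Fintype F] [Algebra (ZMod p) F] (hF : Fintype.card F = p ^ n) :
    (d' = d ∧ p ^ d % 4 = 3 →
      ∑ α : {a : F // a ^ p ^ m = a}, ∑ β : F, (Tsum p m n k F α.1 β) ^ 2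
        = (p : ℂ) ^ (3 * m)) ∧
    (d' = d ∧ p ^ d % 4 = 1 →
      ∑ α : {a : F // a ^ p ^ m = a}, ∑ β : F, (Tsum p m n k F α.1 β) ^ 2
        = (2 * (p : ℂ) ^ n - 1) * (p : ℂ) ^ (3 * m)) ∧
    (d' = 2 * d →
      ∑ α : {a : F // a ^ p ^ m = a}, ∑ β : F, (Tsum p m n k F α.1 β) ^ 2
        = ((p : ℂ) ^ (n + d) + (p : ℂ) ^ n - (p : ℂ) ^ d) * (p : ℂ) ^ (3 * m)) := by
  have : Fact p.Prime := ⟨hp⟩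
  have : CharP F p := charP_of_injective_algebraMap (algebraMap (ZMod p) F).injective p
  have : ExpChar F p := ExpChar.prime hp
  have hpodd : Odd p := Nat.odd_iff.2 hodd
  have hchar : (2 : F) ≠ 0 := by
    intro h2
    have : p ∣ 2 := (CharP.cast_eq_zero_iff F p 2).1 (by exact_mod_cast h2)
    have := (Nat.prime_dvd_prime_iff_eq hp Nat.prime_two).1 this
    omega
  rw [sum_Tsum_sq hm hn hF]
  subst hd hd'
  refine ⟨fun ⟨h, h4⟩ => ?_, fun ⟨h, h4⟩ => ?_, fun h => ?_⟩
  · rw [Finset.filter_false_of_mem]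
    · simp
    · rintro z - hz
      obtain ⟨hz₁, hz₂⟩ := (pow_eq_neg_one_iff_of_gcd_eq hpodd h z).1 hz
      rw [pow_eq_neg_of_mod_four_eq_three h4 hz₂] at hz₁
      have h2z : (2 : F) * z = 0 := by linear_combination -hz₁
      have hz0 : z = 0 := (mul_eq_zero.1 h2z).resolve_left hchar
      simp [hz0] at hz₂
  · have hiff : ∀ z : F, (z ^ (p ^ m + 1) = -1 ∧ z ^ (p ^ k + 1) = -1) ↔ z ^ 2 = -1 := fun z =>
      (pow_eq_neg_one_iff_of_gcd_eq hpodd h z).trans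
        ⟨And.right, fun hz => ⟨pow_eq_self_of_mod_four_eq_one h4 hz, hz⟩⟩
    simp only [hiff]
    rw [card_filter_pow_eq_neg_one (by rw [hF, hn]; exact four_dvd_pow_two_mul_sub_one hpodd m)]
    push_cast
    ring
  · simp only [pow_eq_neg_one_iff_of_gcd_eq_two_mul hpodd hm h]
    rw [card_filter_pow_eq_neg_one
      (by rw [hF, hn]; exact two_mul_pow_add_one_dvd hpodd (Nat.gcd_dvd_left m k))]
    push_cast
    ring
end
end
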